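/- Let a > 0. Then as t → 0⁺, the Dirichlet heat trace of the isosceles right triangle with legs of length a satisfies ∑_{m > n ≥ 1} exp(−π²(m² + n²) t/a²) = a²/(8πt) − a(2 + √2)/(8√(πt)) + 3/8 − (a/(2√(2πt)))·e^{−a²/(2t)} + (a²/(2πt))·e^{−a²/t} + O(t^{−1/2} e^{−a²/t}). -/

import Mathlib

open Real Filter Asymptotics
open scoped Topology

/-- The sum of `exp (-x k²)` over the positive integers `k`. -/
noncomputable def halfTheta (x : ℝ) : ℝ := ∑' n : ℕ, Real.exp (-x * ((n : ℝ) + 1) ^ 2)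

lemma exp_neg_mul_sq_le {x : ℝ} (hx : 0 < x) (n : ℕ) :
    Real.exp (-x * ((n : ℝ) + 1 + 1) ^ 2) ≤ Real.exp (-x) ^ 4 * Real.exp (-x) ^ n := by
  rw [← pow_add, ← Real.exp_nat_mul, Real.exp_le_exp]
  push_cast
  nlinarith [mul_nonneg hx.le (sq_nonneg (n : ℝ)), mul_nonneg hx.le (Nat.cast_nonneg' n : (0:ℝ) ≤ n)]

lemma summable_exp_neg_mul_succ_sq {x : ℝ} (hx : 0 < x) :
    Summable fun n : ℕ => Real.exp (-x * ((n : ℝ) + 1) ^ 2) := by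
  rw [← summable_nat_add_iff 1]
  have hg := (summable_geometric_of_lt_one (Real.exp_pos (-x)).le
    (Real.exp_lt_one_iff.mpr (neg_lt_zero.mpr hx))).mul_left (Real.exp (-x) ^ 4)
  refine Summable.of_nonneg_of_le (fun _ => (Real.exp_pos _).le) (fun n => ?_) hg
  simpa using exp_neg_mul_sq_le hx n

/-- The first term of `halfTheta x` dominates once `exp (-x) ≤ 1 / 2`. -/
lemma halfTheta_sub_exp_mem {x : ℝ} (hx : 0 < x) (h : Real.exp (-x) ≤ 1 / 2) :
    0 ≤ halfTheta x - Real.exp (-x) ∧ halfTheta x - Real.exp (-x) ≤ 2 * Real.exp (-x) ^ 4 := by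
  have hs := summable_exp_neg_mul_succ_sq hx
  have hg := (hasSum_geometric_of_lt_one (Real.exp_pos (-x)).le
    (Real.exp_lt_one_iff.mpr (neg_lt_zero.mpr hx))).mul_left (Real.exp (-x) ^ 4)
  have e : halfTheta x - Real.exp (-x)
      = ∑' n : ℕ, Real.exp (-x * ((n : ℝ) + 1 + 1) ^ 2) := by
    rw [halfTheta, hs.tsum_eq_zero_add]
    simp
  rw [e]
  refine ⟨tsum_nonneg fun _ => (Real.exp_pos _).le, ?_⟩
  have hs' : Summable fun n : ℕ => Real.exp (-x * ((n : ℝ) + 1 + 1) ^ 2) := by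
    simpa using (summable_nat_add_iff 1).mpr hs
  have h1 := hs'.tsum_le_tsum (exp_neg_mul_sq_le hx) hg.summable
  rw [hg.tsum_eq] at h1
  have h2 : (1 - Real.exp (-x))⁻¹ ≤ 2 := by
    rw [inv_le_comm₀ (by linarith) two_pos]
    linarith
  nlinarith [pow_pos (Real.exp_pos (-x)) 4]

lemma tsum_int_exp_neg_mul_sq {x : ℝ} (hx : 0 < x) :
    ∑' n : ℤ, Real.exp (-x * (n : ℝ) ^ 2) = 1 + 2 * halfTheta x := by
  have hs := (summable_exp_neg_mul_succ_sq hx).hasSum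
  have h := HasSum.of_add_one_of_neg_add_one (f := fun n : ℤ => Real.exp (-x * (n : ℝ) ^ 2))
    (m := halfTheta x) (m' := halfTheta x)
    (by simpa [halfTheta] using hs)
    (by
      rw [halfTheta]
      convert hs using 3 with n
      push_cast
      ring_nf)
  rw [h.tsum_eq]
  simp
  ring

/-- Poisson summation for `halfTheta`. -/
lemma one_add_two_mul_halfTheta {u : ℝ} (hu : 0 < u) :
    1 + 2 * halfTheta (π ^ 2 * u) = 1 / √(π * u) * (1 + 2 * halfTheta (1 / u)) := by
  have hpu : 0 < π * u := mul_pos pi_pos hu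
  rw [← tsum_int_exp_neg_mul_sq (by positivity), ← tsum_int_exp_neg_mul_sq (by positivity),
    Real.sqrt_eq_rpow]
  convert Real.tsum_exp_neg_mul_int_sq hpu using 4
  · ring_nf
  · congr 2
    field_simp

/-- The sum over pairs `m > n ≥ 1` expressed through `halfTheta`. -/
lemma tsum_exp_neg_mul_sq_add_sq {x : ℝ} (hx : 0 < x) :
    ∑' p : {p : ℕ × ℕ // 1 ≤ p.2 ∧ p.2 < p.1},
        Real.exp (-x * ((p.1.1 : ℝ) ^ 2 + (p.1.2 : ℝ) ^ 2))
      = (halfTheta x ^ 2 - halfTheta (2 * x)) / 2 := by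
  have hs := summable_exp_neg_mul_succ_sq hx
  set F : ℕ × ℕ → ℝ := fun p =>
    Real.exp (-x * ((p.1 : ℝ) + 1) ^ 2) * Real.exp (-x * ((p.2 : ℝ) + 1) ^ 2) with hF
  have hFs : Summable F :=
    hs.mul_of_nonneg hs (fun _ => (Real.exp_pos _).le) (fun _ => (Real.exp_pos _).le)
  have hsq : halfTheta x ^ 2 = ∑' p, F p := by
    rw [sq, halfTheta, hs.tsum_mul_tsum hs hFs]
  set L : Set (ℕ × ℕ) := {p | p.2 < p.1}
  set D : Set (ℕ × ℕ) := {p | p.1 = p.2}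
  set U : Set (ℕ × ℕ) := {p | p.1 < p.2}
  have hsplit : ∑' p, F p
      = ∑' p, L.indicator F p + ∑' p, D.indicator F p + ∑' p, U.indicator F p := by
    rw [← (hFs.indicator L).tsum_add (hFs.indicator D),
      ← ((hFs.indicator L).add (hFs.indicator D)).tsum_add (hFs.indicator U)]
    congr 1 with ⟨m, n⟩
    rcases lt_trichotomy m n with h | h | h
    · simp [L, D, U, Set.indicator, h, h.ne, h.not_gt]
    · simp [L, D, U, Set.indicator, h]
    · simp [L, D, U, Set.indicator, h, h.ne', h.not_gt]
  have hU : ∑' p, U.indicator F p = ∑' p, L.indicator F p := by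
    rw [← (Equiv.prodComm ℕ ℕ).tsum_eq]
    congr 1 with ⟨m, n⟩
    simp [L, U, Set.indicator, hF, mul_comm]
  have hD : ∑' p, D.indicator F p = halfTheta (2 * x) := by
    have hinj : Function.Injective fun n : ℕ => (n, n) := fun m n h => (Prod.ext_iff.mp h).1
    rw [← hinj.tsum_eq]
    · rw [halfTheta]
      congr 1 with n
      simp only [D, hF, Set.indicator, Set.mem_ofPred_eq, if_true, ← Real.exp_add]
      ring_nf
    · rintro ⟨m, n⟩ h
      have h' : (m, n) ∈ D := Set.mem_of_indicator_ne_zero h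
      exact ⟨m, Prod.ext rfl h'⟩
  have hL : ∑' p : {p : ℕ × ℕ // 1 ≤ p.2 ∧ p.2 < p.1},
        Real.exp (-x * ((p.1.1 : ℝ) ^ 2 + (p.1.2 : ℝ) ^ 2)) = ∑' p, L.indicator F p := by
    have hinj : Function.Injective fun p : ℕ × ℕ => (p.1 + 1, p.2 + 1) := by
      rintro ⟨m, n⟩ ⟨m', n'⟩ h
      simpa using h
    have e := tsum_subtype {p : ℕ × ℕ | 1 ≤ p.2 ∧ p.2 < p.1}
      fun p => Real.exp (-x * ((p.1 : ℝ) ^ 2 + (p.2 : ℝ) ^ 2))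
    refine e.trans ?_
    rw [← hinj.tsum_eq]
    · congr 1 with ⟨m, n⟩
      simp [L, hF, Set.indicator, ← Real.exp_add, mul_add]
    · rintro ⟨m, n⟩ h
      have h' : (m, n) ∈ {p : ℕ × ℕ | 1 ≤ p.2 ∧ p.2 < p.1} := Set.mem_of_indicator_ne_zero h
      obtain ⟨hn, hmn⟩ : 1 ≤ n ∧ n < m := h'
      exact ⟨(m - 1, n - 1), by ext <;> simp <;> omega⟩
  rw [hL, hsq, hsplit, hU, hD]
  ring

/-- The remainder of the heat trace, written with `A = a / √(π t)`, `q = exp (-a² / t)` and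
tails `E₁`, `E₂` of the two theta series. -/
lemma abs_heat_trace_remainder_le {A q E₁ E₂ c : ℝ} (hA : 0 ≤ A) (hq : 0 ≤ q) (hq1 : q ≤ 1)
    (hAq : A * q ≤ 1) (h1 : 0 ≤ E₁) (h1' : E₁ ≤ 2 * q ^ 4) (h2 : 0 ≤ E₂) (h2' : E₂ ≤ 2 * q ^ 2)
    (hc : 0 ≤ c) (hc1 : c ≤ 1) :
    |A ^ 2 * ((q + E₁) ^ 2 + E₁) / 2 - A * (q + E₁) / 2 - c * A * E₂ / 2| ≤ 9 * (A * q) := by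
  have q2 : q ^ 2 ≤ q := by nlinarith
  have q4 : q ^ 4 ≤ q ^ 2 := by nlinarith [sq_nonneg q]
  have hE1 : E₁ ≤ 2 * q := by linarith
  have b1 : (q + E₁) ^ 2 + E₁ ≤ 11 * q ^ 2 := by nlinarith
  have b2 : A ^ 2 * ((q + E₁) ^ 2 + E₁) ≤ A ^ 2 * (11 * q ^ 2) := by gcongr
  have b3 : (A * q) ^ 2 ≤ A * q := by nlinarith [mul_nonneg hA hq]
  have b4 : A * (q + E₁) ≤ A * (3 * q) := by gcongr; linarith
  have b5 : c * A * E₂ ≤ 1 * A * (2 * q) := by gcongr; linarith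
  have p1 : 0 ≤ A ^ 2 * ((q + E₁) ^ 2 + E₁) := by positivity
  have p2 : 0 ≤ A * (q + E₁) := by positivity
  have p3 : 0 ≤ c * A * E₂ := by positivity
  have p4 : 0 ≤ A * q := by positivity
  rw [abs_le]
  constructor <;> nlinarith

/-- **Sharp short-time asymptotics of the Dirichlet heat trace of the isosceles right
triangle** with legs of length `a`: as `t → 0⁺`,
`∑_{m > n ≥ 1} exp(−π²(m² + n²)t/a²)
  = a²/(8πt) − a(2+√2)/(8√(πt)) + 3/8 − (a/(2√(2πt)))e^{−a²/(2t)}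
    + (a²/(2πt))e^{−a²/t} + O(t^{−1/2} e^{−a²/t})`. -/
theorem isoscelesRight_dirichlet_heat_trace_asymptotics (a : ℝ) (ha : 0 < a) :
    (fun t : ℝ =>
      (∑' p : {p : ℕ × ℕ // 1 ≤ p.2 ∧ p.2 < p.1},
          Real.exp (-(π ^ 2 * ((p.1.1 : ℝ) ^ 2 + (p.1.2 : ℝ) ^ 2)) * t / a ^ 2))
        - (a ^ 2 / (8 * π * t) - a * (2 + Real.sqrt 2) / (8 * Real.sqrt (π * t)) + 3 / 8
            - a / (2 * Real.sqrt (2 * π * t)) * Real.exp (-a ^ 2 / (2 * t))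
            + a ^ 2 / (2 * π * t) * Real.exp (-a ^ 2 / t)))
      =O[𝓝[>] (0 : ℝ)]
    (fun t : ℝ => t ^ (-(1 : ℝ) / 2) * Real.exp (-a ^ 2 / t)) := by
  refine IsBigO.of_bound (9 * (a / √π)) ?_
  filter_upwards [Ioo_mem_nhdsGT (show (0 : ℝ) < a ^ 2 / 2 by positivity)] with t ht
  obtain ⟨ht, hta⟩ := ht
  have hu : 0 < t / a ^ 2 := by positivity
  have hu2 : 0 < 2 * (t / a ^ 2) := by positivity
  have hsum : (∑' p : {p : ℕ × ℕ // 1 ≤ p.2 ∧ p.2 < p.1},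
      Real.exp (-(π ^ 2 * ((p.1.1 : ℝ) ^ 2 + (p.1.2 : ℝ) ^ 2)) * t / a ^ 2))
      = (halfTheta (π ^ 2 * (t / a ^ 2)) ^ 2 - halfTheta (π ^ 2 * (2 * (t / a ^ 2)))) / 2 := by
    rw [mul_left_comm (π ^ 2) 2, ← tsum_exp_neg_mul_sq_add_sq (by positivity)]
    congr 1 with p
    ring_nf
  have hP := one_add_two_mul_halfTheta hu
  have hP2 := one_add_two_mul_halfTheta hu2
  set q := Real.exp (-a ^ 2 / t) with hq
  set p := Real.exp (-a ^ 2 / (2 * t)) with hp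
  have hpq : q = p ^ 2 := by
    rw [hq, hp, ← Real.exp_nat_mul]
    congr 1
    push_cast
    field_simp
  have hp0 : 0 < p := Real.exp_pos _
  have hq0 : 0 < q := Real.exp_pos _
  have eq1 : Real.exp (-(1 / (t / a ^ 2))) = q := by
    rw [hq]; congr 1; field_simp
  have ep1 : Real.exp (-(1 / (2 * (t / a ^ 2)))) = p := by
    rw [hp]; congr 1; field_simp
  have hp2 : p ≤ 1 / 2 := by
    have h1 : 1 ≤ a ^ 2 / (2 * t) := by
      rw [le_div_iff₀ (by positivity)]; linarith
    have h2 := Real.add_one_le_exp (a ^ 2 / (2 * t))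
    rw [hp, neg_div, Real.exp_neg, one_div]
    exact inv_anti₀ two_pos (by linarith)
  have hq2 : q ≤ 1 / 2 := by rw [hpq]; nlinarith
  obtain ⟨h1, h1'⟩ := halfTheta_sub_exp_mem (x := 1 / (t / a ^ 2)) (by positivity)
    (by rwa [eq1])
  obtain ⟨h2, h2'⟩ := halfTheta_sub_exp_mem (x := 1 / (2 * (t / a ^ 2))) (by positivity)
    (by rwa [ep1])
  rw [eq1] at h1 h1'
  rw [ep1] at h2 h2'
  have hs2 : √2 ^ 2 = 2 := Real.sq_sqrt two_pos.le
  have hs2pos : 0 < √2 := by positivity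
  have hpt : 0 < √(π * t) := by positivity
  have hpt2 : √(π * t) ^ 2 = π * t := Real.sq_sqrt (by positivity)
  have hA1 : 1 / √(π * (t / a ^ 2)) = a / √(π * t) := by
    rw [← mul_div_assoc, Real.sqrt_div (by positivity), Real.sqrt_sq ha.le, one_div_div]
  have hA2 : 1 / √(π * (2 * (t / a ^ 2))) = a / √(π * t) / √2 := by
    rw [show π * (2 * (t / a ^ 2)) = 2 * (π * (t / a ^ 2)) by ring,
      Real.sqrt_mul two_pos.le, mul_comm, ← div_div, hA1]
  have hA3 : a / (2 * √(2 * π * t)) = a / √(π * t) / √2 / 2 := by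
    rw [mul_assoc, Real.sqrt_mul two_pos.le]
    field_simp
  have hA4 : a * (2 + √2) / (8 * √(π * t)) = a / √(π * t) / 4 + a / √(π * t) / √2 / 4 := by
    field_simp
    linear_combination (4 : ℝ) * hs2
  have hA5 : a ^ 2 / (8 * π * t) = (a / √(π * t)) ^ 2 / 8 := by
    rw [div_pow, hpt2]; field_simp
  have hA6 : a ^ 2 / (2 * π * t) = (a / √(π * t)) ^ 2 / 2 := by
    rw [div_pow, hpt2]; field_simp
  rw [hA1] at hP
  rw [hA2] at hP2
  have hA7 : a / √π * t ^ (-(1 : ℝ) / 2) = a / √(π * t) := by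
    rw [neg_div, Real.rpow_neg ht.le, ← Real.sqrt_eq_rpow, Real.sqrt_mul pi_pos.le]
    field_simp
  have hAq : a / √(π * t) * q ≤ 1 := by
    have h3 := Real.add_one_le_exp (a ^ 2 / t)
    have h4 : a ^ 2 / t = π * (a / √(π * t)) ^ 2 := by
      rw [div_pow, hpt2]; field_simp
    rw [hq, neg_div, Real.exp_neg, ← div_eq_mul_inv, div_le_one (Real.exp_pos _)]
    nlinarith [Real.pi_gt_three, sq_nonneg (a / √(π * t) - 1), sq_nonneg (a / √(π * t))]
  rw [hsum, hA3, hA4, hA5, hA6, Real.norm_eq_abs, Real.norm_eq_abs,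
    abs_of_nonneg (a := t ^ (-(1 : ℝ) / 2) * q) (by positivity),
    show 9 * (a / √π) * (t ^ (-(1 : ℝ) / 2) * q) = 9 * (a / √π * t ^ (-(1 : ℝ) / 2) * q) by ring,
    hA7]
  set A := a / √(π * t)
  set X := halfTheta (1 / (t / a ^ 2))
  set Y := halfTheta (1 / (2 * (t / a ^ 2)))
  have hb := abs_heat_trace_remainder_le (A := A) (c := 1 / √2) (by positivity) hq0.le
    (by linarith) hAq h1 h1' h2 (by rw [hpq]; linarith) (by positivity)
    (by rw [div_le_one hs2pos]; exact Real.one_le_sqrt.mpr one_le_two)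
  convert hb using 2
  rw [show halfTheta (π ^ 2 * (t / a ^ 2)) = (A * (1 + 2 * X) - 1) / 2 by linarith,
    show halfTheta (π ^ 2 * (2 * (t / a ^ 2))) = (A / √2 * (1 + 2 * Y) - 1) / 2 by linarith]
  ring
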